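/- Define f_b^k(z; w₁,…,w_b) = ∏_{j≤k}(q^ℓ w_j − z) · ∏_{j>k}(w_j − q^ℓ z) and α_b = ∏_{i=1}^{b}(1 − q^{2ℓ+2−2i}) / [b]_q!, where [n]_q = (qⁿ − q^{−n})/(q − q^{−1}) and [b]_q! = [b]_q[b−1]_q⋯[1]_q. Then Σ_{k=0}^{b} ((−1)^k q^{k(ℓ−b+1)} / ([k]_q! [b−k]_q!)) · f_b^k(z; w₁,…,w_b) equals α_b · ∏_{i=1}^b w_i plus a linear combination of terms each divisible by (w_i − q^{−2} w_{i+1}) for some i < b. -/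

import Mathlib

open Finset MvPolynomial

/-- The q-integer `[n]_q = (qⁿ − q^{−n})/(q − q^{−1})`. -/
noncomputable def qint {K : Type*} [Field K] (q : K) (n : ℕ) : K :=
  (q ^ n - q⁻¹ ^ n) / (q - q⁻¹)

/-- The q-factorial `[n]_q! = [n]_q [n−1]_q ⋯ [1]_q`. -/
noncomputable def qfact {K : Type*} [Field K] (q : K) (n : ℕ) : K :=
  ∏ i ∈ Finset.range n, qint q (i + 1)

/-- Gaussian binomial coefficients in the parameter `v`, normalised so that they satisfy
`c (b + 1) (k + 1) = c b (k + 1) + v ^ b * c b k`. -/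
def gaussCoeff {R : Type*} [CommRing R] (v : R) : ℕ → ℕ → R
  | 0, 0 => 1
  | 0, _ + 1 => 0
  | b + 1, 0 => gaussCoeff v b 0
  | b + 1, k + 1 => gaussCoeff v b (k + 1) + v ^ b * gaussCoeff v b k

theorem gaussCoeff_zero_right {R : Type*} [CommRing R] (v : R) (b : ℕ) :
    gaussCoeff v b 0 = 1 := by
  induction b with
  | zero => rfl
  | succ b ih => exact ih

theorem gaussCoeff_eq_zero {R : Type*} [CommRing R] (v : R) (b : ℕ) :
    ∀ k, b < k → gaussCoeff v b k = 0 := by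
  induction b with
  | zero => rintro (_ | k) hk; exacts [absurd hk (lt_irrefl _), rfl]
  | succ b ih =>
    rintro (_ | k) hk
    · omega
    · simp [gaussCoeff, ih (k + 1) (by omega), ih k (by omega)]

theorem map_gaussCoeff {R S : Type*} [CommRing R] [CommRing S] (φ : R →+* S) (v : R) (b : ℕ) :
    ∀ k, φ (gaussCoeff v b k) = gaussCoeff (φ v) b k := by
  induction b with
  | zero => rintro (_ | k) <;> simp [gaussCoeff]
  | succ b ih => rintro (_ | k) <;> simp [gaussCoeff, ih]

/-- The specialisation of the sum to the geometric progression `w_{j+1} = Q ^ j * w`. -/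
theorem sum_gaussCoeff_mul_prod {R : Type*} [CommRing R] (Q v a z : R) (hQ : v * Q = 1) (b : ℕ) :
    ∀ w : R, ∑ k ∈ range (b + 1), (-a) ^ k * gaussCoeff v b k *
        ∏ j ∈ range b, (if j < k then a * (Q ^ j * w) - z else Q ^ j * w - a * z) =
      w ^ b * ∏ i ∈ range b, (Q ^ i - a ^ 2) := by
  induction b with
  | zero => simp [gaussCoeff]
  | succ b ih =>
    intro w
    have hvQ : v ^ b * Q ^ b = 1 := by rw [← mul_pow, hQ, one_pow]
    have hlow : ∑ k ∈ range (b + 1 + 1), (-a) ^ k * gaussCoeff v b k *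
        ∏ j ∈ range (b + 1), (if j < k then a * (Q ^ j * w) - z else Q ^ j * w - a * z) =
        (Q ^ b * w - a * z) * (w ^ b * ∏ i ∈ range b, (Q ^ i - a ^ 2)) := by
      rw [sum_range_succ, gaussCoeff_eq_zero v b (b + 1) (by omega), ← ih w, mul_sum]
      simp only [mul_zero, zero_mul, add_zero]
      refine sum_congr rfl fun k hk => ?_
      rw [prod_range_succ, if_neg (by simp at hk; omega)]
      ring
    have hhigh : ∑ k ∈ range (b + 1), (-a) ^ (k + 1) * (v ^ b * gaussCoeff v b k) *
        ∏ j ∈ range (b + 1), (if j < k + 1 then a * (Q ^ j * w) - z else Q ^ j * w - a * z) =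
        -a * (a * w - z) * (w ^ b * ∏ i ∈ range b, (Q ^ i - a ^ 2)) := by
      have h := congrArg (fun t => -a * (a * w - z) * v ^ b * t) (ih (Q * w))
      have hr : -a * (a * w - z) * v ^ b * ((Q * w) ^ b * ∏ i ∈ range b, (Q ^ i - a ^ 2)) =
          -a * (a * w - z) * (w ^ b * ∏ i ∈ range b, (Q ^ i - a ^ 2)) := by
        rw [mul_pow]
        linear_combination (-a * (a * w - z) * (w ^ b * ∏ i ∈ range b, (Q ^ i - a ^ 2))) * hvQ
      simp only [hr] at h
      rw [← h, mul_sum]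
      refine sum_congr rfl fun k _ => ?_
      rw [prod_range_succ']
      simp only [Nat.add_lt_add_iff_right, Nat.zero_lt_succ, if_true, pow_succ, mul_assoc,
        pow_zero, one_mul]
      ring
    rw [sum_range_succ'] at hlow ⊢
    simp only [gaussCoeff, mul_add, add_mul, sum_add_distrib] at hlow ⊢
    rw [hhigh, add_right_comm, hlow, prod_range_succ]
    ring

theorem qfact_succ {K : Type*} [Field K] (q : K) (n : ℕ) :
    qfact q (n + 1) = qfact q n * qint q (n + 1) := prod_range_succ _ _

theorem qfact_ne_zero {K : Type*} [Field K] {q : K}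
    (hqi : ∀ n : ℕ, 1 ≤ n → qint q n ≠ 0) (n : ℕ) : qfact q n ≠ 0 :=
  prod_ne_zero_iff.2 fun _ _ => hqi _ (Nat.le_add_left _ _)

theorem qint_add {K : Type*} [Field K] (q : K) (m n : ℕ) :
    qint q (m + n) = q ^ n * qint q m + q⁻¹ ^ m * qint q n := by
  simp only [qint, pow_add]
  ring

theorem gaussCoeff_mul_qfact {K : Type*} [Field K] {q : K} (hq : q ≠ 0) (n : ℕ) :
    ∀ k m, k + m = n → gaussCoeff (q⁻¹ ^ 2) n k * (qfact q k * qfact q m) * q ^ (k * n) =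
      q ^ k * qfact q n := by
  induction n with
  | zero =>
    intro k m h
    obtain ⟨rfl, rfl⟩ : k = 0 ∧ m = 0 := by omega
    simp [gaussCoeff, qfact]
  | succ n ih =>
    rintro (_ | k) m h
    · obtain rfl : m = n + 1 := by omega
      simp [gaussCoeff_zero_right, qfact]
    · have hk := ih k m (by omega)
      have hk' : gaussCoeff (q⁻¹ ^ 2) n (k + 1) * (qfact q (k + 1) * qfact q m) *
          q ^ ((k + 1) * n) = q ^ (k + 1) * qfact q n * qint q m := by
        rcases m with _ | m
        · simp [gaussCoeff_eq_zero _ n (k + 1) (by omega), qint]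
        · rw [qfact_succ q m, ← ih (k + 1) m (by omega)]
          ring
      have hn : (q⁻¹ ^ 2) ^ n * q ^ n * q ^ k = q⁻¹ ^ m := by
        obtain rfl : n = k + m := by omega
        simp only [inv_pow]
        field_simp
        ring
      have hadd := qint_add q m (k + 1)
      rw [show m + (k + 1) = n + 1 by omega] at hadd
      rw [gaussCoeff, qfact_succ q n, hadd]
      rw [qfact_succ q k] at hk' ⊢
      linear_combination q ^ (k + 1) * hk' +
        (q⁻¹ ^ 2) ^ n * q ^ (n + k + 1) * qint q (k + 1) * hk +
        q ^ (k + 1) * qint q (k + 1) * qfact q n * hn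

theorem coeff_eq_gaussCoeff {K : Type*} [Field K] {q : K} (hq : q ≠ 0)
    (hqi : ∀ n : ℕ, 1 ≤ n → qint q n ≠ 0) {ℓ b k : ℕ} (hbℓ : b ≤ ℓ) (hk : k ≤ b) :
    (-1 : K) ^ k * q ^ (k * (ℓ - b + 1)) / (qfact q k * qfact q (b - k)) =
      (qfact q b)⁻¹ * ((-q ^ ℓ) ^ k * gaussCoeff (q⁻¹ ^ 2) b k) := by
  have h := gaussCoeff_mul_qfact hq b k (b - k) (by omega)
  have h₁ := qfact_ne_zero hqi k
  have h₂ := qfact_ne_zero hqi (b - k)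
  have h₃ := qfact_ne_zero hqi b
  obtain ⟨d, rfl⟩ := Nat.exists_eq_add_of_le hbℓ
  rw [Nat.add_sub_cancel_left, div_eq_iff (mul_ne_zero h₁ h₂), inv_mul_eq_div,
    div_mul_eq_mul_div, eq_div_iff h₃, neg_pow (q ^ (b + d)), ← pow_mul]
  linear_combination -(-1) ^ k * q ^ (k * d) * h

theorem prod_one_sub_mul_prod {R : Type*} [CommRing R] (Q v a w : R) (hQ : v * Q = 1) (b : ℕ) :
    (∏ i ∈ range b, (1 - a ^ 2 * v ^ i)) * ∏ j ∈ range b, (Q ^ j * w) =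
      w ^ b * ∏ i ∈ range b, (Q ^ i - a ^ 2) := by
  rw [← prod_mul_distrib, ← card_range b, ← prod_const, card_range, ← prod_mul_distrib]
  refine prod_congr rfl fun i _ => ?_
  have h : v ^ i * Q ^ i = 1 := by rw [← mul_pow, hQ, one_pow]
  linear_combination -a ^ 2 * w * h

/-- The identity of the theorem after any specialisation in which `w_i = q⁻² w_{i+1}`. -/
theorem sum_coeff_mul_prod {K R : Type*} [Field K] [CommRing R] (φ : K →+* R) {q : K} (hq : q ≠ 0)
    (hqi : ∀ n : ℕ, 1 ≤ n → qint q n ≠ 0) {ℓ b : ℕ} (hbℓ : b ≤ ℓ) (z : R) (w : ℕ → R)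
    (hw : ∀ i < b - 1, w i = φ (q⁻¹ ^ 2) * w (i + 1)) :
    ∑ k ∈ range (b + 1),
        φ ((-1 : K) ^ k * q ^ (k * (ℓ - b + 1)) / (qfact q k * qfact q (b - k))) *
          ∏ j ∈ range b, (if j < k then φ (q ^ ℓ) * w j - z else w j - φ (q ^ ℓ) * z) =
      φ ((∏ i ∈ range b, (1 - q ^ (2 * ℓ + 2 - 2 * (i + 1)))) / qfact q b) *
        ∏ j ∈ range b, w j := by
  have hvq : q⁻¹ ^ 2 * q ^ 2 = 1 := by rw [← mul_pow, inv_mul_cancel₀ hq, one_pow]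
  have hvQ : φ (q⁻¹ ^ 2) * φ (q ^ 2) = 1 := by rw [← map_mul, hvq, map_one]
  have hgeom : ∀ j < b, w j = φ (q ^ 2) ^ j * w 0 := by
    intro j
    induction j with
    | zero => simp
    | succ j ih =>
      intro hj
      linear_combination φ (q ^ 2) * ih (by omega) - φ (q ^ 2) * hw j (by omega) -
        w (j + 1) * hvQ
  have hα : ∏ i ∈ range b, (1 - q ^ (2 * ℓ + 2 - 2 * (i + 1))) =
      ∏ i ∈ range b, (1 - (q ^ ℓ) ^ 2 * (q⁻¹ ^ 2) ^ i) := by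
    refine prod_congr rfl fun i hi => ?_
    have hi' := mem_range.1 hi
    obtain ⟨d, rfl⟩ := Nat.exists_eq_add_of_le (show i ≤ ℓ by omega)
    have h : (q⁻¹ ^ 2) ^ i * (q ^ 2) ^ i = 1 := by rw [← mul_pow, hvq, one_pow]
    rw [show 2 * (i + d) + 2 - 2 * (i + 1) = 2 * d by omega]
    linear_combination q ^ (2 * d) * h
  rw [hα, div_eq_inv_mul, map_mul, mul_assoc, map_prod,
    prod_congr rfl fun j hj => hgeom j (mem_range.1 hj)]
  simp only [map_sub, map_one, map_mul, map_pow φ (q ^ ℓ), map_pow φ (q⁻¹ ^ 2)]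
  rw [prod_one_sub_mul_prod _ _ _ _ hvQ, ← sum_gaussCoeff_mul_prod _ _ _ z hvQ, mul_sum]
  refine sum_congr rfl fun k hk => ?_
  rw [coeff_eq_gaussCoeff hq hqi hbℓ (by simpa [Nat.lt_succ_iff] using hk), map_mul, mul_assoc,
    map_mul, map_gaussCoeff, map_pow, map_neg]
  congr 2
  refine prod_congr rfl fun j hj => ?_
  rw [hgeom j (mem_range.1 hj)]

/-- With `z = X 0` and `w_j = X j` (`1 ≤ j ≤ b`),
`Σ_{k=0}^{b} ((−1)^k q^{k(ℓ−b+1)}/([k]![b−k]!)) f_b^k(z;w₁,…,w_b)` equals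
`α_b ∏ w_i` plus a combination of terms divisible by `(w_i − q^{−2} w_{i+1})`,
where `f_b^k = ∏_{j≤k}(q^ℓ w_j − z)∏_{j>k}(w_j − q^ℓ z)` and
`α_b = ∏_{i=1}^b (1 − q^{2ℓ+2−2i}) / [b]_q!`. -/
theorem stmt2 (K : Type*) [Field K] (q : K) (hq : q ≠ 0)
    (hqi : ∀ n : ℕ, 1 ≤ n → qint q n ≠ 0)
    (ℓ b : ℕ) (hb : 1 ≤ b) (hbℓ : b ≤ ℓ) :
    ∃ c : ℕ → MvPolynomial ℕ K,
      (∑ k ∈ Finset.range (b + 1),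
          C ((-1 : K) ^ k * q ^ (k * (ℓ - b + 1)) / (qfact q k * qfact q (b - k))) *
            ∏ j ∈ Finset.range b,
              (if j < k then C (q ^ ℓ) * X (j + 1) - X 0
               else X (j + 1) - C (q ^ ℓ) * X 0)) =
        C ((∏ i ∈ Finset.range b, (1 - q ^ (2 * ℓ + 2 - 2 * (i + 1)))) / qfact q b) *
            (∏ j ∈ Finset.range b, X (j + 1)) +
          ∑ i ∈ Finset.range (b - 1),
            (X (i + 1) - C (q⁻¹ ^ 2) * X (i + 2)) * c i := by
  set I : Ideal (MvPolynomial ℕ K) := Ideal.span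
    (Set.image (fun i : ℕ => (X (i + 1) - C (q⁻¹ ^ 2) * X (i + 2) : MvPolynomial ℕ K))
      (range (b - 1) : Set ℕ))
  have h := sum_coeff_mul_prod ((Ideal.Quotient.mk I).comp C) hq hqi hbℓ
    (Ideal.Quotient.mk I (X 0)) (fun j => Ideal.Quotient.mk I (X (j + 1))) fun i hi => by
      rw [RingHom.comp_apply, ← map_mul, Ideal.Quotient.mk_eq_mk_iff_sub_mem]
      exact Ideal.subset_span ⟨i, by simpa using hi, rfl⟩
  simp only [RingHom.comp_apply, ← map_mul, ← map_sub, ← map_prod, ← apply_ite, ← map_sum,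
    Ideal.Quotient.mk_eq_mk_iff_sub_mem] at h
  obtain ⟨c, hc⟩ := (Submodule.mem_span_image_finset_iff_exists_fun' _).1 h
  refine ⟨c, ?_⟩
  rw [← sub_eq_iff_eq_add', ← hc]
  exact sum_congr rfl fun i _ => by rw [smul_eq_mul, mul_comm]
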